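/- Let μ ⊢ n, λ ⊨ n, and let l be maximal such that μ_l > 0. Let A_1,…,A_r be row-standard μ-tableaux of type λ which are identical in row l. Write μ̃ = (μ_1,…,μ_{l−1}) ⊢ n − μ_l and let Ã_1,…,Ã_r be the μ̃-tableaux obtained by deleting row l from each A_i; these have a common type λ̃ ⊨ n − μ_l. If c_1,…,c_r ∈ 𝔽 satisfy ∑_{i=1}^r c_i φ̂_{Ã_i} = 0 (as homomorphisms S^{μ̃} → M^{λ̃} over H_{n−μ_l}), then ∑_{i=1}^r c_i φ̂_{A_i} = 0 (as homomorphisms S^μ → M^λ over H_n). -/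

import Mathlib

open scoped Classical

noncomputable section

namespace FayersSemistd

/-- The value at `q` of the Gaussian (quantum) binomial coefficient polynomial
`[a choose b]`, defined via the `q`-Pascal recurrence. -/
def qBinom {F : Type*} [Field F] (q : F) : ℕ → ℕ → F
  | _, 0 => 1
  | 0, _+1 => 0
  | a+1, b+1 => qBinom q a b + q ^ (b+1) * qBinom q a (b+1)

/-- `∏_i [A_i + B_i choose A_i]_q`, where `A_i`, `B_i` are multiplicities in the
multisets `A` and `B`. -/
def qBinomProd {F : Type*} [Field F] (q : F) (A B : Multiset ℕ) : F :=
  ∏ i ∈ (A + B).toFinset, qBinom q ((A + B).count i) (A.count i)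

/-- `∑_{i<j} A_j * B_i` : the number of pairs `(x,y)` with `x ∈ A`, `y ∈ B`, `y < x`,
counted with multiplicity. -/
def invPairs (A B : Multiset ℕ) : ℕ :=
  ((A.product B).filter (fun p => p.2 < p.1)).card

/-- The Coxeter length of a permutation of `{0,…,n-1}`: its number of inversions. -/
def permLength {n : ℕ} (w : Equiv.Perm (Fin n)) : ℕ :=
  (Finset.univ.filter (fun p : Fin n × Fin n => p.1 < p.2 ∧ w p.2 < w p.1)).card

/-- `λ_0 + ⋯ + λ_{r-1}`. -/
def cumSum (lam : ℕ → ℕ) (r : ℕ) : ℕ := ∑ i ∈ Finset.range r, lam i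

/-- The (0-indexed) row of the diagram of `λ` containing the (0-indexed) position `p`,
when positions are listed row by row. -/
def rowOf (lam : ℕ → ℕ) (p : ℕ) : ℕ := sInf {r | p < cumSum lam (r+1)}

/-- `λ` is a composition of `n`: finitely many nonzero parts, summing to `n`. -/
def IsComposition (n : ℕ) (lam : ℕ → ℕ) : Prop :=
  ∃ N, (∀ r, N ≤ r → lam r = 0) ∧ cumSum lam N = n

/-- `μ` is a partition of `n`. -/
def IsPartition (n : ℕ) (mu : ℕ → ℕ) : Prop := IsComposition n mu ∧ Antitone mu

/-- The conjugate partition (0-indexed): `conjP μ i = #{r | μ r > i}`. -/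
def conjP (mu : ℕ → ℕ) (i : ℕ) : ℕ := sInf {r | mu r ≤ i}

/-- The standard Young subgroup `W_λ` of `S_n` (as a set): the permutations preserving
each consecutive block of sizes `λ_0, λ_1, …`. -/
def youngW {n : ℕ} (lam : ℕ → ℕ) : Set (Equiv.Perm (Fin n)) :=
  {w | ∀ p : Fin n, rowOf lam ((w p : Fin n) : ℕ) = rowOf lam (p : ℕ)}

/-- The adjacent transposition `(i, i+1)` (0-indexed) in `S_n`. -/
def adjT {n : ℕ} (i : ℕ) (h : i + 1 < n) : Equiv.Perm (Fin n) :=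
  Equiv.swap ⟨i, Nat.lt_of_succ_lt h⟩ ⟨i+1, h⟩

/-- `T : S_n → H` is the standard basis of an Iwahori–Hecke algebra of `S_n` over `F`
with parameter `q`.  Permutations act on the right, so the product `w·s` of the paper
is `s * w` in Mathlib's convention; the multiplication rule
`T_w T_s = T_{ws}` (length increasing) resp. `T_w T_s = q T_{ws} + (q-1) T_w`
(length decreasing) determines the algebra structure on the basis. -/
structure IsHeckeBasis {F : Type*} [Field F] {H : Type*} [Ring H] [Algebra F H] {n : ℕ}
    (q : F) (T : Equiv.Perm (Fin n) → H) : Prop where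
  li : LinearIndependent F T
  total : Submodule.span F (Set.range T) = ⊤
  one : T 1 = 1
  mul_adj_asc : ∀ (w : Equiv.Perm (Fin n)) (i : ℕ) (h : i + 1 < n),
    permLength w < permLength (adjT i h * w) →
    T w * T (adjT i h) = T (adjT i h * w)
  mul_adj_desc : ∀ (w : Equiv.Perm (Fin n)) (i : ℕ) (h : i + 1 < n),
    permLength (adjT i h * w) < permLength w →
    T w * T (adjT i h) = q • T (adjT i h * w) + (q - 1) • T w

variable {F : Type*} [Field F] {H : Type*} [Ring H] [Algebra F H] {n : ℕ}

/-- `x_λ = ∑_{w ∈ W_λ} T_w`. -/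
def xElt (T : Equiv.Perm (Fin n) → H) (lam : ℕ → ℕ) : H :=
  ∑ w ∈ Finset.univ.filter (· ∈ youngW lam), T w

/-- `y_λ = ∑_{w ∈ W_λ} (-q)^{-l(w)} T_w`. -/
def yElt (q : F) (T : Equiv.Perm (Fin n) → H) (lam : ℕ → ℕ) : H :=
  ∑ w ∈ Finset.univ.filter (· ∈ youngW lam), ((-q)⁻¹) ^ permLength w • T w

/-- The double coset `W_λ d W_μ` (paper convention: maps act on the right, so the
paper product `u·d·v` is `v * d * u` in Mathlib's convention). -/
def doubleCoset {n : ℕ} (lam mu : ℕ → ℕ) (d : Equiv.Perm (Fin n)) :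
    Set (Equiv.Perm (Fin n)) :=
  {w | ∃ u ∈ youngW (n := n) lam, ∃ v ∈ youngW (n := n) mu, w = v * d * u}

/-- `∑_{w ∈ W_λ 1_A W_μ} T_w`, the image `x_μ φ_A` of `x_μ` under the tableau
homomorphism `φ_A : M^μ → M^λ`, where `d = 1_A`. -/
def XPhi (T : Equiv.Perm (Fin n) → H) (lam mu : ℕ → ℕ) (d : Equiv.Perm (Fin n)) : H :=
  ∑ w ∈ Finset.univ.filter (· ∈ doubleCoset lam mu d), T w

/-- A row-standard tableau is recorded by the multisets of entries of its rows; it has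
shape `μ` when row `r` has `μ_r` entries. -/
def RowsOfShape (mu : ℕ → ℕ) (A : ℕ → Multiset ℕ) : Prop := ∀ r, (A r).card = mu r

/-- The tableau with rows `A 0, A 1, …` has type `λ` when the entry `v` occurs `λ_v`
times in total (entries and types are 0-indexed). -/
def HasType (A : ℕ → Multiset ℕ) (lam : ℕ → ℕ) : Prop :=
  ∀ v, (∑ᶠ r, (A r).count v) = lam v

/-- The entry in row `r`, column `c` (0-indexed) of the row-standard tableau with row
multisets `A`. -/
def entryAt (A : ℕ → Multiset ℕ) (r c : ℕ) : ℕ := ((A r).sort (· ≤ ·)).getD c 0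

/-- `d = 1_A` for the row-standard `μ`-tableau `A` of type `λ`: the tableau `t^λ d`
(whose entry at position `p` is `d p`) is row-standard (first clause), and the entry
`d p` lies in row `r` of `t^λ d` exactly when the position occupied by `d p` in `t^μ`
is occupied by `r` in `A` (second clause). -/
def Is1A {n : ℕ} (mu lam : ℕ → ℕ) (A : ℕ → Multiset ℕ) (d : Equiv.Perm (Fin n)) : Prop :=
  (∀ p p' : Fin n, rowOf lam (p : ℕ) = rowOf lam (p' : ℕ) → p < p' → d p < d p') ∧
  (∀ p : Fin n,
    entryAt A (rowOf mu ((d p : Fin n) : ℕ))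
      (((d p : Fin n) : ℕ) - cumSum mu (rowOf mu ((d p : Fin n) : ℕ)))
      = rowOf lam (p : ℕ))

/-- A row-standard tableau is semistandard if its columns are strictly increasing. -/
def Semistandard (mu : ℕ → ℕ) (A : ℕ → Multiset ℕ) : Prop :=
  ∀ r c, c < mu (r+1) → entryAt A r c < entryAt A (r+1) c

/-- The (0-indexed) column of the position `p` in the diagram of `μ`. -/
def colIdx (mu : ℕ → ℕ) (p : ℕ) : ℕ := p - cumSum mu (rowOf mu p)

/-- `w = w_μ`, i.e. `t^μ w = t_μ`: the image of position `p` is the number of positions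
coming strictly before `p` in the column-reading order of the diagram of `μ`. -/
def IsWmu {n : ℕ} (mu : ℕ → ℕ) (w : Equiv.Perm (Fin n)) : Prop :=
  ∀ p : Fin n, ((w p : Fin n) : ℕ) = (Finset.univ.filter (fun p' : Fin n =>
    colIdx mu (p' : ℕ) < colIdx mu (p : ℕ) ∨
      (colIdx mu (p' : ℕ) = colIdx mu (p : ℕ) ∧ rowOf mu (p' : ℕ) < rowOf mu (p : ℕ)))).card

def comp1 (a : ℕ) : ℕ → ℕ := fun r => if r = 0 then a else 0
def comp2 (a b : ℕ) : ℕ → ℕ := fun r => if r = 0 then a else if r = 1 then b else 0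
def comp3 (a b c : ℕ) : ℕ → ℕ :=
  fun r => if r = 0 then a else if r = 1 then b else if r = 2 then c else 0
def comp4 (a b c d : ℕ) : ℕ → ℕ :=
  fun r => if r = 0 then a else if r = 1 then b else if r = 2 then c else if r = 3 then d else 0
def rows1 (a : Multiset ℕ) : ℕ → Multiset ℕ := fun r => if r = 0 then a else 0
def rows2 (a b : Multiset ℕ) : ℕ → Multiset ℕ :=
  fun r => if r = 0 then a else if r = 1 then b else 0
def rows3 (a b c : Multiset ℕ) : ℕ → Multiset ℕ :=
  fun r => if r = 0 then a else if r = 1 then b else if r = 2 then c else 0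
def rows4 (a b c d : Multiset ℕ) : ℕ → Multiset ℕ :=
  fun r => if r = 0 then a else if r = 1 then b else if r = 2 then c else if r = 3 then d else 0

end FayersSemistd
namespace FayersSemistd

section FactorThroughRowRemoval

variable {n : ℕ}

section HeckeBasis

variable {F : Type*} [Field F] {H : Type*} [Ring H] [Algebra F H]

lemma adjT_val {i : ℕ} (h : i + 1 < n) (x : Fin n) :
    ((adjT i h x : Fin n) : ℕ) =
      if (x : ℕ) = i then i + 1 else if (x : ℕ) = i + 1 then i else x := by
  unfold adjT
  rw [Equiv.swap_apply_def]
  simp only [Fin.ext_iff]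
  split_ifs <;> rfl

lemma permLength_adjT_mul {w : Equiv.Perm (Fin n)} {i : ℕ} (h : i + 1 < n)
    (hw : w⁻¹ ⟨i, Nat.lt_of_succ_lt h⟩ < w⁻¹ ⟨i + 1, h⟩) :
    permLength (adjT i h * w) = permLength w + 1 := by
  unfold permLength
  rw [← Finset.card_insert_of_notMem (a := (w⁻¹ ⟨i, Nat.lt_of_succ_lt h⟩, w⁻¹ ⟨i + 1, h⟩))]
  · congr 1
    ext ⟨a, b⟩
    rw [Finset.mem_filter, Finset.mem_insert, Finset.mem_filter]
    simp only [Finset.mem_univ, true_and, Prod.mk.injEq, Equiv.Perm.mul_apply,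
      Equiv.Perm.eq_inv_iff_eq]
    constructor
    · rintro ⟨hab, hlt⟩
      rw [Fin.lt_def, adjT_val, adjT_val] at hlt
      have hne : ((w a : Fin n) : ℕ) ≠ w b := fun e => hab.ne (w.injective (Fin.ext e))
      simp only [Fin.ext_iff, Fin.lt_def] at *
      split_ifs at hlt <;> omega
    · rintro (⟨ha, hb⟩ | ⟨hab, hlt⟩)
      · rw [← Equiv.Perm.eq_inv_iff_eq] at ha hb
        refine ⟨by rw [ha, hb]; exact hw, ?_⟩
        rw [Fin.lt_def, adjT_val, adjT_val, ha, hb]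
        simp
      · refine ⟨hab, ?_⟩
        rw [Fin.lt_def, adjT_val, adjT_val]
        have key : ¬ (((w a : Fin n) : ℕ) = i + 1 ∧ ((w b : Fin n) : ℕ) = i) := by
          rintro ⟨ha, hb⟩
          have ha' : a = w⁻¹ ⟨i + 1, h⟩ := by rw [Equiv.Perm.eq_inv_iff_eq]; exact Fin.ext ha
          have hb' : b = w⁻¹ ⟨i, Nat.lt_of_succ_lt h⟩ := by
            rw [Equiv.Perm.eq_inv_iff_eq]; exact Fin.ext hb
          rw [ha', hb'] at hab
          exact lt_asymm hab hw
        rw [Fin.lt_def] at hlt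
        split_ifs <;> omega
  · simp

lemma adjT_mul_adjT_mul {i : ℕ} (h : i + 1 < n) (w : Equiv.Perm (Fin n)) :
    adjT i h * (adjT i h * w) = w := by
  unfold adjT
  rw [← mul_assoc, Equiv.swap_mul_self, one_mul]

lemma adjT_inv {i : ℕ} (h : i + 1 < n) : (adjT i h)⁻¹ = adjT i h := Equiv.swap_inv _ _

lemma inv_lt_inv_adjT_mul {w : Equiv.Perm (Fin n)} {i : ℕ} (h : i + 1 < n)
    (hw : w⁻¹ ⟨i + 1, h⟩ < w⁻¹ ⟨i, Nat.lt_of_succ_lt h⟩) :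
    (adjT i h * w)⁻¹ ⟨i, Nat.lt_of_succ_lt h⟩ < (adjT i h * w)⁻¹ ⟨i + 1, h⟩ := by
  rw [mul_inv_rev, adjT_inv, Equiv.Perm.mul_apply, Equiv.Perm.mul_apply]
  simpa [adjT] using hw

/-- Every permutation is built from the identity by length-increasing multiplications by
adjacent transpositions. -/
theorem perm_induction {P : Equiv.Perm (Fin n) → Prop} (one : P 1)
    (step : ∀ (w : Equiv.Perm (Fin n)) (i : ℕ) (h : i + 1 < n),
      w⁻¹ ⟨i, Nat.lt_of_succ_lt h⟩ < w⁻¹ ⟨i + 1, h⟩ → P w → P (adjT i h * w))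
    (w : Equiv.Perm (Fin n)) : P w := by
  induction hk : permLength w using Nat.strong_induction_on generalizing w with
  | _ k ih =>
    by_cases hw : ∃ (i : ℕ) (h : i + 1 < n), w⁻¹ ⟨i + 1, h⟩ < w⁻¹ ⟨i, Nat.lt_of_succ_lt h⟩
    · obtain ⟨i, h, hlt⟩ := hw
      have h1 := inv_lt_inv_adjT_mul h hlt
      have h2 := permLength_adjT_mul h h1
      rw [adjT_mul_adjT_mul] at h2
      rw [← adjT_mul_adjT_mul h w]
      exact step _ i h h1 (ih _ (by omega) _ rfl)
    · push Not at hw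
      have hmono : StrictMono (w⁻¹ : Equiv.Perm (Fin n)) := by
        cases n with
        | zero => exact fun a => a.elim0
        | succ n =>
          rw [Fin.strictMono_iff_lt_succ]
          intro i
          refine lt_of_le_of_ne (hw i (by omega)) fun e => ?_
          have := (w⁻¹).injective e
          simp [Fin.ext_iff] at this
      have : w⁻¹ = 1 := (Equiv.Perm.monotone_iff _).mp hmono.monotone
      rw [inv_eq_one] at this
      exact this ▸ one

lemma permLength_one : permLength (1 : Equiv.Perm (Fin n)) = 0 := by
  unfold permLength
  rw [Finset.card_eq_zero, Finset.filter_eq_empty_iff]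
  rintro x - ⟨h1, h2⟩
  exact lt_asymm h1 h2

lemma IsHeckeBasis.mul_of_asc {q : F} {T : Equiv.Perm (Fin n) → H} (hT : IsHeckeBasis q T)
    {w : Equiv.Perm (Fin n)} {i : ℕ} (h : i + 1 < n)
    (hw : w⁻¹ ⟨i, Nat.lt_of_succ_lt h⟩ < w⁻¹ ⟨i + 1, h⟩) :
    T w * T (adjT i h) = T (adjT i h * w) :=
  hT.mul_adj_asc w i h (by rw [permLength_adjT_mul h hw]; omega)

lemma IsHeckeBasis.mul_of_desc {q : F} {T : Equiv.Perm (Fin n) → H} (hT : IsHeckeBasis q T)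
    {w : Equiv.Perm (Fin n)} {i : ℕ} (h : i + 1 < n)
    (hw : w⁻¹ ⟨i + 1, h⟩ < w⁻¹ ⟨i, Nat.lt_of_succ_lt h⟩) :
    T w * T (adjT i h) = q • T (adjT i h * w) + (q - 1) • T w := by
  refine hT.mul_adj_desc w i h ?_
  have h2 := permLength_adjT_mul h (inv_lt_inv_adjT_mul h hw)
  rw [adjT_mul_adjT_mul] at h2
  omega

/-- Every inversion of `w` stays an inversion of `u * w`; equivalently, the lengths of `w`
and `u` add up. -/
def PreservesInv (w u : Equiv.Perm (Fin n)) : Prop :=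
  ∀ a b, a < b → w b < w a → u (w b) < u (w a)

lemma PreservesInv.of_adjT_mul {w u : Equiv.Perm (Fin n)} {i : ℕ} {h : i + 1 < n}
    (hu : u⁻¹ ⟨i, Nat.lt_of_succ_lt h⟩ < u⁻¹ ⟨i + 1, h⟩)
    (hw : PreservesInv w (adjT i h * u)) :
    PreservesInv w u ∧
      (u * w)⁻¹ ⟨i, Nat.lt_of_succ_lt h⟩ < (u * w)⁻¹ ⟨i + 1, h⟩ := by
  constructor
  · intro a b hab hlt
    have h1 := hw a b hab hlt
    by_contra hcon
    have h2 : ((u (w a) : Fin n) : ℕ) ≠ u (w b) := fun e =>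
      hlt.ne' (u.injective (Fin.ext e))
    rw [Equiv.Perm.mul_apply, Equiv.Perm.mul_apply, Fin.lt_def, adjT_val, adjT_val] at h1
    rw [Fin.lt_def] at hcon
    have h3 : ((u (w a) : Fin n) : ℕ) = i ∧ ((u (w b) : Fin n) : ℕ) = i + 1 := by
      split_ifs at h1 <;> omega
    have ha : w a = u⁻¹ ⟨i, Nat.lt_of_succ_lt h⟩ := by
      rw [Equiv.Perm.eq_inv_iff_eq]; exact Fin.ext h3.1
    have hb : w b = u⁻¹ ⟨i + 1, h⟩ := by
      rw [Equiv.Perm.eq_inv_iff_eq]; exact Fin.ext h3.2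
    rw [ha, hb] at hlt
    exact lt_asymm hlt hu
  · rw [mul_inv_rev, Equiv.Perm.mul_apply, Equiv.Perm.mul_apply]
    by_contra hcon
    have hne : w⁻¹ (u⁻¹ ⟨i, Nat.lt_of_succ_lt h⟩) ≠ w⁻¹ (u⁻¹ ⟨i + 1, h⟩) := fun e => by
      simp [Fin.ext_iff] at e
    have h1 := hw _ _ (lt_of_le_of_ne (not_lt.mp hcon) hne.symm) (by simpa using hu)
    rw [Fin.lt_def] at h1
    simp [adjT] at h1

lemma IsHeckeBasis.mul_eq {q : F} {T : Equiv.Perm (Fin n) → H} (hT : IsHeckeBasis q T)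
    {w u : Equiv.Perm (Fin n)} (hwu : PreservesInv w u) : T w * T u = T (u * w) := by
  induction u using perm_induction with
  | one => rw [hT.one, mul_one, one_mul]
  | step u i h hu ih =>
    obtain ⟨h1, h2⟩ := hwu.of_adjT_mul hu
    rw [← hT.mul_of_asc h hu, ← mul_assoc, ih h1, hT.mul_of_asc h h2, mul_assoc]

lemma PreservesInv.permLength_mul {w u : Equiv.Perm (Fin n)} (hwu : PreservesInv w u) :
    permLength (u * w) = permLength w + permLength u := by
  induction u using perm_induction with
  | one => rw [one_mul, permLength_one, add_zero]
  | step u i h hu ih =>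
    obtain ⟨h1, h2⟩ := hwu.of_adjT_mul hu
    rw [mul_assoc, permLength_adjT_mul h h2, permLength_adjT_mul h hu, ih h1, add_assoc]

/-- The standard embedding of the symmetric group on the first `m` letters. -/
def permEmb {m n : ℕ} (h : m ≤ n) : Equiv.Perm (Fin m) →* Equiv.Perm (Fin n) :=
  Equiv.Perm.viaEmbeddingHom (Fin.castLEEmb h)

section Embedding

variable {m : ℕ} (hmn : m ≤ n)

lemma permEmb_castLE (u : Equiv.Perm (Fin m)) (x : Fin m) :
    permEmb hmn u (Fin.castLE hmn x) = Fin.castLE hmn (u x) :=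
  Equiv.Perm.viaEmbedding_apply u (Fin.castLEEmb hmn) x

lemma permEmb_of_le (u : Equiv.Perm (Fin m)) {x : Fin n} (hx : m ≤ x) :
    permEmb hmn u x = x := by
  refine Equiv.Perm.viaEmbedding_apply_of_notMem u (Fin.castLEEmb hmn) x ?_
  rintro ⟨y, rfl⟩
  exact absurd y.2 (not_lt.mpr hx)

lemma permEmb_lt (u : Equiv.Perm (Fin m)) {x : Fin n} (hx : (x : ℕ) < m) :
    ((permEmb hmn u x : Fin n) : ℕ) < m := by
  have : x = Fin.castLE hmn ⟨x, hx⟩ := rfl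
  rw [this, permEmb_castLE]
  exact (u _).2

lemma permEmb_adjT {i : ℕ} (h : i + 1 < m) :
    permEmb hmn (adjT i h) = adjT i (h.trans_le hmn) := by
  ext x
  by_cases hx : (x : ℕ) < m
  · have : x = Fin.castLE hmn ⟨x, hx⟩ := rfl
    rw [this, permEmb_castLE, Fin.val_castLE, adjT_val, adjT_val]
    rfl
  · rw [permEmb_of_le hmn _ (not_lt.mp hx), adjT_val, if_neg (by omega), if_neg (by omega)]

lemma permEmb_inv_lt_iff (u : Equiv.Perm (Fin m)) (a b : Fin m) :
    (permEmb hmn u)⁻¹ (Fin.castLE hmn a) < (permEmb hmn u)⁻¹ (Fin.castLE hmn b) ↔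
      u⁻¹ a < u⁻¹ b := by
  rw [← map_inv, permEmb_castLE, permEmb_castLE]
  rfl

lemma permLength_permEmb (u : Equiv.Perm (Fin m)) :
    permLength (permEmb hmn u) = permLength u := by
  induction u using perm_induction with
  | one => rw [map_one, permLength_one, permLength_one]
  | step u i h hu ih =>
    rw [map_mul, permEmb_adjT, permLength_adjT_mul h hu, permLength_adjT_mul, ih]
    exact (permEmb_inv_lt_iff hmn u _ _).mpr hu

/-- The linear map sending `T'_u` to `T_u`, for `u` in the symmetric group on the first
`m` letters. -/
def heckeEmb {H' : Type*} [Ring H'] [Algebra F H'] {q : F} {T' : Equiv.Perm (Fin m) → H'}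
    (hT' : IsHeckeBasis q T') (T : Equiv.Perm (Fin n) → H) : H' →ₗ[F] H :=
  (Module.Basis.mk hT'.li hT'.total.ge).constr F fun u => T (permEmb hmn u)

section

variable {H' : Type*} [Ring H'] [Algebra F H'] {q : F} {T' : Equiv.Perm (Fin m) → H'}
  (hT' : IsHeckeBasis q T') {T : Equiv.Perm (Fin n) → H}

lemma heckeEmb_apply (u : Equiv.Perm (Fin m)) :
    heckeEmb hmn hT' T (T' u) = T (permEmb hmn u) := by
  have := (Module.Basis.mk hT'.li hT'.total.ge).constr_basis F
    (fun u => T (permEmb hmn u)) u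
  rwa [Module.Basis.mk_apply] at this

lemma heckeEmb_mul_adjT (hT : IsHeckeBasis q T) (a : H') {i : ℕ} (h : i + 1 < m) :
    heckeEmb hmn hT' T (a * T' (adjT i h)) =
      heckeEmb hmn hT' T a * heckeEmb hmn hT' T (T' (adjT i h)) := by
  have ha : a ∈ Submodule.span F (Set.range T') := hT'.total ▸ Submodule.mem_top
  induction ha using Submodule.span_induction with
  | mem x hx =>
    obtain ⟨w, rfl⟩ := hx
    have hne : w⁻¹ ⟨i, Nat.lt_of_succ_lt h⟩ ≠ w⁻¹ ⟨i + 1, h⟩ := fun e => by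
      simp [Fin.ext_iff] at e
    rcases lt_or_gt_of_ne hne with hw | hw
    · rw [hT'.mul_of_asc h hw]
      simp only [heckeEmb_apply, map_mul, permEmb_adjT]
      rw [hT.mul_of_asc]
      exact (permEmb_inv_lt_iff hmn w _ _).mpr hw
    · rw [hT'.mul_of_desc h hw]
      simp only [heckeEmb_apply, map_mul, map_add, map_smul, permEmb_adjT]
      rw [hT.mul_of_desc]
      exact (permEmb_inv_lt_iff hmn w _ _).mpr hw
  | zero => simp
  | add x y _ _ hx hy => rw [add_mul, map_add, hx, hy, map_add, add_mul]
  | smul c x _ hx => rw [smul_mul_assoc, map_smul, hx, map_smul, smul_mul_assoc]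

lemma heckeEmb_mul (hT : IsHeckeBasis q T) (a b : H') :
    heckeEmb hmn hT' T (a * b) = heckeEmb hmn hT' T a * heckeEmb hmn hT' T b := by
  have hb : b ∈ Submodule.span F (Set.range T') := hT'.total ▸ Submodule.mem_top
  induction hb using Submodule.span_induction with
  | mem x hx =>
    obtain ⟨u, rfl⟩ := hx
    induction u using perm_induction with
    | one => rw [heckeEmb_apply, map_one, hT.one, hT'.one, mul_one, mul_one]
    | step u i h hu ih =>
      rw [← hT'.mul_of_asc h hu, ← mul_assoc, heckeEmb_mul_adjT hmn hT' hT, ih, mul_assoc,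
        heckeEmb_mul_adjT hmn hT' hT]
  | zero => simp
  | add x y _ _ hx hy => rw [mul_add, map_add, hx, hy, map_add, mul_add]
  | smul c x _ hx => rw [mul_smul_comm, map_smul, hx, map_smul, mul_smul_comm]

end

lemma preservesInv_permEmb_left (w : Equiv.Perm (Fin m)) (g : Equiv.Perm (Fin n))
    (hg : ∀ a b : Fin m, a < b → w b < w a →
      g (Fin.castLE hmn (w b)) < g (Fin.castLE hmn (w a))) :
    PreservesInv (permEmb hmn w) g := by
  intro a b hab hlt
  by_cases hb : (b : ℕ) < m
  · have ha : (a : ℕ) < m := lt_trans hab hb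
    have ea : a = Fin.castLE hmn ⟨a, ha⟩ := rfl
    have eb : b = Fin.castLE hmn ⟨b, hb⟩ := rfl
    rw [ea, eb, permEmb_castLE, permEmb_castLE] at hlt ⊢
    exact hg _ _ hab hlt
  · rw [permEmb_of_le hmn w (not_lt.mp hb)] at hlt
    by_cases ha : (a : ℕ) < m
    · have := permEmb_lt hmn w ha
      rw [Fin.lt_def] at hlt
      omega
    · rw [permEmb_of_le hmn w (not_lt.mp ha)] at hlt
      exact absurd hab (lt_asymm hlt)

lemma preservesInv_permEmb_right (f : Equiv.Perm (Fin n)) (u : Equiv.Perm (Fin m))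
    (hf : ∀ a b : Fin m, a < b → f⁻¹ (Fin.castLE hmn a) < f⁻¹ (Fin.castLE hmn b)) :
    PreservesInv f (permEmb hmn u) := by
  intro a b hab hlt
  by_cases ha : ((f a : Fin n) : ℕ) < m
  · have hb : ((f b : Fin n) : ℕ) < m := lt_trans hlt ha
    have := hf ⟨f b, hb⟩ ⟨f a, ha⟩ hlt
    have ea : Fin.castLE hmn ⟨f a, ha⟩ = f a := rfl
    have eb : Fin.castLE hmn ⟨f b, hb⟩ = f b := rfl
    rw [ea, eb, Equiv.Perm.inv_def, Equiv.symm_apply_apply, Equiv.symm_apply_apply] at this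
    exact absurd this (lt_asymm hab)
  · rw [permEmb_of_le hmn u (not_lt.mp ha)]
    by_cases hb : ((f b : Fin n) : ℕ) < m
    · have := permEmb_lt hmn u hb
      rw [Fin.lt_def]
      omega
    · rwa [permEmb_of_le hmn u (not_lt.mp hb)]

end Embedding

end HeckeBasis

section Decomposition

variable {m : ℕ} (hmn : m ≤ n)

/-- `f` is increasing on the intersection of the first `m` letters with each fibre of `β`. -/
def IncreasingOnFibers (β : Fin m → ℕ) (f : Equiv.Perm (Fin n)) : Prop :=
  ∀ a b : Fin m, a < b → β a = β b → f (Fin.castLE hmn a) < f (Fin.castLE hmn b)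

lemma comp_perm_eq_of_monotone {α : Type*} [LinearOrder α] {f : Fin m → α}
    (hf : Monotone f) {σ : Equiv.Perm (Fin m)} (hσ : Monotone (f ∘ σ)) : f ∘ σ = f := by
  have h1 := Tuple.comp_sort_eq_comp_iff_monotone.mpr hσ
  have h2 := (Tuple.comp_sort_eq_comp_iff_monotone (σ := 1) (f := f)).mpr hf
  exact h1.trans h2.symm

lemma exists_increasing_mul {β : Fin m → ℕ} (hβ : Monotone β) (w : Equiv.Perm (Fin n)) :
    ∃ (f : Equiv.Perm (Fin n)) (u : Equiv.Perm (Fin m)),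
      IncreasingOnFibers hmn β f ∧ (∀ x, β (u x) = β x) ∧ f * permEmb hmn u = w := by
  let k : Fin m → ℕ ×ₗ Fin n := fun x => toLex (β x, w (Fin.castLE hmn x))
  set σ := Tuple.sort k
  have hk : Monotone (k ∘ σ) := Tuple.monotone_sort k
  have hlex : ∀ a b, a ≤ b → β (σ a) < β (σ b) ∨
      β (σ a) = β (σ b) ∧ w (Fin.castLE hmn (σ a)) ≤ w (Fin.castLE hmn (σ b)) :=
    fun a b hab => Prod.Lex.le_iff.mp (hk hab)
  have hσ : ∀ x, β (σ x) = β x := congrFun <| comp_perm_eq_of_monotone hβ fun a b hab => by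
    rcases hlex a b hab with h | h
    · exact h.le
    · exact h.1.le
  refine ⟨w * permEmb hmn σ, σ⁻¹, ?_, ?_, by simp⟩
  · intro a b hab hβab
    rw [Equiv.Perm.mul_apply, Equiv.Perm.mul_apply, permEmb_castLE, permEmb_castLE]
    rcases hlex a b hab.le with h | h
    · rw [hσ, hσ, hβab] at h
      exact absurd h (lt_irrefl _)
    · refine lt_of_le_of_ne h.2 fun e => hab.ne ?_
      exact σ.injective (Fin.castLE_injective hmn (w.injective e))
  · intro x
    rw [← hσ, Equiv.Perm.inv_def, Equiv.apply_symm_apply]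

lemma increasing_mul_unique {β : Fin m → ℕ} (hβ : Monotone β) {f f' : Equiv.Perm (Fin n)}
    {u u' : Equiv.Perm (Fin m)} (hf : IncreasingOnFibers hmn β f)
    (hf' : IncreasingOnFibers hmn β f') (hu : ∀ x, β (u x) = β x)
    (hu' : ∀ x, β (u' x) = β x) (h : f * permEmb hmn u = f' * permEmb hmn u') :
    f = f' ∧ u = u' := by
  have hft : f = f' * permEmb hmn (u' * u⁻¹) := by
    rw [map_mul, ← mul_assoc, ← h, map_inv, mul_inv_cancel_right]
  have ht : ∀ x, β ((u' * u⁻¹) x) = β x := fun x => by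
    rw [Equiv.Perm.mul_apply, hu', ← hu, Equiv.Perm.inv_def, Equiv.apply_symm_apply]
  generalize hteq : u' * u⁻¹ = t at hft ht
  have hmono : StrictMono t := by
    intro a b hab
    by_contra hcon
    have hlt : t b < t a := lt_of_le_of_ne (not_lt.mp hcon) fun e => hab.ne' (t.injective e)
    have h1 : β a = β b := by
      have := hβ hlt.le
      rw [ht, ht] at this
      exact le_antisymm (hβ hab.le) this
    have h2 := hf a b hab h1
    rw [hft, Equiv.Perm.mul_apply, Equiv.Perm.mul_apply, permEmb_castLE, permEmb_castLE] at h2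
    exact lt_asymm h2 (hf' _ _ hlt (by rw [ht, ht, h1]))
  have ht1 : t = 1 := (Equiv.Perm.monotone_iff _).mp hmono.monotone
  subst ht1
  refine ⟨by simpa using hft, (mul_inv_eq_one.mp hteq).symm⟩

/-- Summation over a symmetric group, organised by cosets of a Young subgroup of the
symmetric group on the first `m` letters. -/
lemma sum_perm_eq_sum_increasing {M : Type*} [AddCommMonoid M] {β : Fin m → ℕ}
    (hβ : Monotone β) (G : Equiv.Perm (Fin n) → M) :
    ∑ w, G w = ∑ f ∈ Finset.univ.filter (IncreasingOnFibers hmn β),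
      ∑ u ∈ Finset.univ.filter (fun u : Equiv.Perm (Fin m) => ∀ x, β (u x) = β x),
        G (f * permEmb hmn u) := by
  rw [← Finset.sum_product']
  symm
  refine Finset.sum_bij (fun x _ => x.1 * permEmb hmn x.2) (fun _ _ => Finset.mem_univ _)
    ?_ ?_ (fun _ _ => rfl)
  · rintro ⟨f, u⟩ hx ⟨f', u'⟩ hx' h
    simp only [Finset.mem_product, Finset.mem_filter, Finset.mem_univ, true_and] at hx hx'
    obtain ⟨h1, h2⟩ := increasing_mul_unique hmn hβ hx.1 hx'.1 hx.2 hx'.2 h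
    rw [h1, h2]
  · intro w _
    obtain ⟨f, u, hf, hu, h⟩ := exists_increasing_mul hmn hβ w
    exact ⟨(f, u), by simp [hf, hu], h⟩

end Decomposition

section Rows

lemma cumSum_succ (lam : ℕ → ℕ) (r : ℕ) : cumSum lam (r + 1) = cumSum lam r + lam r :=
  Finset.sum_range_succ _ _

lemma cumSum_mono (lam : ℕ → ℕ) : Monotone (cumSum lam) :=
  monotone_nat_of_le_succ fun r => by rw [cumSum_succ]; omega

lemma cumSum_rowOf_le (lam : ℕ → ℕ) (p : ℕ) : cumSum lam (rowOf lam p) ≤ p := by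
  rcases hr : rowOf lam p with _ | r
  · simp [cumSum]
  · have : r ∉ {r | p < cumSum lam (r + 1)} := Nat.notMem_of_lt_sInf (by
      change r < rowOf lam p
      omega)
    exact not_lt.mp this

lemma lt_cumSum_rowOf_succ {lam : ℕ → ℕ} {p N : ℕ} (h : p < cumSum lam N) :
    p < cumSum lam (rowOf lam p + 1) :=
  Nat.sInf_mem (s := {r | p < cumSum lam (r + 1)})
    ⟨N, h.trans_le (cumSum_mono lam N.le_succ)⟩

lemma rowOf_eq {lam : ℕ → ℕ} {p r : ℕ} (h1 : cumSum lam r ≤ p) (h2 : p < cumSum lam (r + 1)) :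
    rowOf lam p = r := by
  refine le_antisymm (Nat.sInf_le h2) (not_lt.mp fun hlt => ?_)
  have := lt_cumSum_rowOf_succ h2
  have := cumSum_mono lam (Nat.succ_le_of_lt hlt)
  simp only [Nat.succ_eq_add_one] at this
  omega

lemma rowOf_mono {lam : ℕ → ℕ} {p p' N : ℕ} (hp : p ≤ p') (h : p' < cumSum lam N) :
    rowOf lam p ≤ rowOf lam p' :=
  Nat.sInf_le (lt_of_le_of_lt hp (lt_cumSum_rowOf_succ h))

lemma IsComposition.cumSum_le {lam : ℕ → ℕ} (h : IsComposition n lam) (r : ℕ) :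
    cumSum lam r ≤ n := by
  obtain ⟨N, hN, rfl⟩ := h
  rcases le_total r N with hr | hr
  · exact cumSum_mono lam hr
  · refine le_of_eq (Finset.sum_subset (Finset.range_subset_range.mpr hr) ?_).symm
    intro x _ hx
    exact hN x (by simpa using hx)

end Rows

section DoubleCosets

lemma exists_perm_comp_eq {α β : Type*} [Fintype α] (f g : α → β)
    (h : ∀ b, (Finset.univ.filter (fun x => f x = b)).card =
      (Finset.univ.filter (fun x => g x = b)).card) :
    ∃ σ : Equiv.Perm α, ∀ x, f (σ x) = g x := by
  have e : ∀ b, {x // g x = b} ≃ {x // f x = b} := fun b =>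
    Fintype.equivOfCardEq (by rw [Fintype.card_subtype, Fintype.card_subtype, h b])
  refine ⟨(Equiv.sigmaFiberEquiv g).symm.trans
    ((Equiv.sigmaCongrRight e).trans (Equiv.sigmaFiberEquiv f)), fun x => ?_⟩
  exact (e (g x) ⟨x, rfl⟩).2

/-- The number of letters `s` in the `r`-th row of the `μ`-tableau of type `λ` attached to
`w`. -/
def rowCount (mu lam : ℕ → ℕ) (w : Equiv.Perm (Fin n)) (r s : ℕ) : ℕ :=
  (Finset.univ.filter fun k : Fin n =>
    rowOf mu (k : ℕ) = r ∧ rowOf lam ((w⁻¹ k : Fin n) : ℕ) = s).card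

lemma exists_perm_of_rowCount_eq {mu lam lam' : ℕ → ℕ} {w d : Equiv.Perm (Fin n)}
    (h : ∀ r s, rowCount mu lam w r s = rowCount mu lam' d r s) :
    ∃ v : Equiv.Perm (Fin n), (∀ k, rowOf mu ((v k : Fin n) : ℕ) = rowOf mu (k : ℕ)) ∧
      ∀ k, rowOf lam ((w⁻¹ (v k) : Fin n) : ℕ) = rowOf lam' ((d⁻¹ k : Fin n) : ℕ) := by
  obtain ⟨v, hv⟩ := exists_perm_comp_eq
    (fun k : Fin n => (rowOf mu (k : ℕ), rowOf lam ((w⁻¹ k : Fin n) : ℕ)))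
    (fun k : Fin n => (rowOf mu (k : ℕ), rowOf lam' ((d⁻¹ k : Fin n) : ℕ)))
    (by rintro ⟨r, s⟩; simpa [rowCount] using h r s)
  exact ⟨v, fun k => congrArg Prod.fst (hv k), fun k => congrArg Prod.snd (hv k)⟩

lemma mem_doubleCoset_iff {mu lam : ℕ → ℕ} {w d : Equiv.Perm (Fin n)} :
    w ∈ doubleCoset lam mu d ↔ ∀ r s, rowCount mu lam w r s = rowCount mu lam d r s := by
  constructor
  · rintro ⟨u, hu, v, hv, rfl⟩ r s
    symm
    refine Finset.card_equiv v fun k => ?_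
    have hu' : rowOf lam ((u⁻¹ (d⁻¹ k) : Fin n) : ℕ) = rowOf lam ((d⁻¹ k : Fin n) : ℕ) := by
      rw [← hu (u⁻¹ (d⁻¹ k)), Equiv.Perm.inv_def, Equiv.apply_symm_apply]
    have hvk : (v * d * u)⁻¹ (v k) = u⁻¹ (d⁻¹ k) := by
      simp [mul_inv_rev, Equiv.Perm.mul_apply]
    simp only [Finset.mem_filter, Finset.mem_univ, true_and]
    rw [hvk, hu', hv k]
  · intro h
    obtain ⟨v, hv1, hv2⟩ := exists_perm_of_rowCount_eq h
    refine ⟨d⁻¹ * v⁻¹ * w, fun p => ?_, v, hv1, by group⟩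
    rw [Equiv.Perm.mul_apply, Equiv.Perm.mul_apply, ← hv2]
    simp

lemma card_rowOf_inv (lam : ℕ → ℕ) (w : Equiv.Perm (Fin n)) (s : ℕ) :
    (Finset.univ.filter fun k : Fin n => rowOf lam ((w⁻¹ k : Fin n) : ℕ) = s).card =
      (Finset.univ.filter fun k : Fin n => rowOf lam (k : ℕ) = s).card :=
  Finset.card_equiv w⁻¹ fun k => by simp

lemma sum_rowCount (mu lam : ℕ → ℕ) (w : Equiv.Perm (Fin n)) (s : ℕ) :
    ∑ r ∈ Finset.univ.image (fun k : Fin n => rowOf mu (k : ℕ)), rowCount mu lam w r s =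
      (Finset.univ.filter fun k : Fin n => rowOf lam (k : ℕ) = s).card := by
  rw [← card_rowOf_inv lam w, Finset.card_eq_sum_card_fiberwise
    (f := fun k : Fin n => rowOf mu (k : ℕ))
    (fun k _ => Finset.mem_coe.mpr
      (Finset.mem_image_of_mem (fun k : Fin n => rowOf mu (k : ℕ)) (Finset.mem_univ k)))]
  refine Finset.sum_congr rfl fun r _ => ?_
  rw [Finset.filter_filter, rowCount]
  simp only [and_comm]

/-- The contents of all rows but one determine the contents of the remaining row. -/
lemma rowCount_eq_of_forall_ne {mu lam : ℕ → ℕ} {w d : Equiv.Perm (Fin n)} {b : ℕ}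
    (h : ∀ r, r ≠ b → ∀ s, rowCount mu lam w r s = rowCount mu lam d r s) (s : ℕ) :
    rowCount mu lam w b s = rowCount mu lam d b s := by
  have h1 := (sum_rowCount mu lam w s).trans (sum_rowCount mu lam d s).symm
  by_cases hb : b ∈ Finset.univ.image (fun k : Fin n => rowOf mu (k : ℕ))
  · rw [← Finset.add_sum_erase _ _ hb, ← Finset.add_sum_erase _ _ hb,
      Finset.sum_congr rfl fun r hr => h r (Finset.ne_of_mem_erase hr) s] at h1
    exact Nat.add_right_cancel h1
  · have : ∀ x : Equiv.Perm (Fin n), rowCount mu lam x b s = 0 := fun x => by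
      rw [rowCount, Finset.card_eq_zero, Finset.filter_eq_empty_iff]
      rintro k - ⟨hk, -⟩
      exact hb (Finset.mem_image.mpr ⟨k, Finset.mem_univ _, hk⟩)
    rw [this, this]

section Restriction

variable {m : ℕ} (hmn : m ≤ n) {mu lam muR lamt : ℕ → ℕ} {b : ℕ}

lemma rowCount_inv_mul_permEmb (hrow : ∀ k : Fin m, rowOf mu (k : ℕ) = rowOf muR (k : ℕ))
    (hlast : ∀ k : Fin n, m ≤ (k : ℕ) → rowOf mu (k : ℕ) = b)
    {f : Equiv.Perm (Fin n)} {u : Equiv.Perm (Fin m)} {r : ℕ} (hr : r ≠ b) (s : ℕ) :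
    rowCount mu lam (f * permEmb hmn u)⁻¹ r s = (Finset.univ.filter fun k : Fin m =>
      rowOf muR (k : ℕ) = r ∧ rowOf lam ((f (Fin.castLE hmn (u k)) : Fin n) : ℕ) = s).card := by
  rw [← Finset.card_map (Fin.castLEEmb hmn), rowCount, inv_inv]
  congr 1
  ext k
  simp only [Finset.mem_filter, Finset.mem_univ, true_and, Finset.mem_map, Fin.castLEEmb_apply]
  constructor
  · rintro ⟨h1, h2⟩
    have hk : (k : ℕ) < m := by
      by_contra hk
      exact hr (h1.symm.trans (hlast k (not_lt.mp hk)))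
    refine ⟨⟨k, hk⟩, ⟨(hrow ⟨k, hk⟩).symm.trans h1, ?_⟩, rfl⟩
    rw [← permEmb_castLE]
    exact h2
  · rintro ⟨j, ⟨h1, h2⟩, rfl⟩
    refine ⟨(hrow j).trans h1, ?_⟩
    rwa [Equiv.Perm.mul_apply, permEmb_castLE]

lemma inv_mul_permEmb_mem_doubleCoset_iff
    (hrow : ∀ k : Fin m, rowOf mu (k : ℕ) = rowOf muR (k : ℕ))
    (hlast : ∀ k : Fin n, m ≤ (k : ℕ) → rowOf mu (k : ℕ) = b)
    (hb : ∀ k : Fin m, rowOf muR (k : ℕ) ≠ b)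
    (hlam : ∀ p p' : Fin n, p ≤ p' → rowOf lam (p : ℕ) ≤ rowOf lam (p' : ℕ))
    (hlamt : ∀ p p' : Fin m, p ≤ p' → rowOf lamt (p : ℕ) ≤ rowOf lamt (p' : ℕ))
    {d : Equiv.Perm (Fin n)} {dt : Equiv.Perm (Fin m)}
    (hcount : ∀ r, r ≠ b → ∀ s, rowCount mu lam d r s = rowCount muR lamt dt r s)
    {f : Equiv.Perm (Fin n)} (hf : IncreasingOnFibers hmn (fun _ : Fin m => 0) f)
    (u : Equiv.Perm (Fin m)) :
    (f * permEmb hmn u)⁻¹ ∈ doubleCoset lam mu d ↔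
      (∀ j : Fin m, rowOf lam ((f (Fin.castLE hmn j) : Fin n) : ℕ) = rowOf lamt (j : ℕ)) ∧
        u⁻¹ ∈ doubleCoset lamt muR dt := by
  have hempty : ∀ φ : Fin m → ℕ, ∀ s, (Finset.univ.filter fun k : Fin m =>
      rowOf muR (k : ℕ) = b ∧ φ k = s).card = 0 := fun φ s => by
    rw [Finset.card_eq_zero, Finset.filter_eq_empty_iff]
    rintro k - ⟨hk, -⟩
    exact hb k hk
  rw [mem_doubleCoset_iff, mem_doubleCoset_iff]
  constructor
  · intro h
    have h1 : ∀ r s, (Finset.univ.filter fun k : Fin m => rowOf muR (k : ℕ) = r ∧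
        rowOf lam ((f (Fin.castLE hmn (u k)) : Fin n) : ℕ) = s).card =
          rowCount muR lamt dt r s := by
      intro r s
      by_cases hr : r = b
      · rw [hr, rowCount, hempty, hempty]
      · rw [← rowCount_inv_mul_permEmb hmn hrow hlast hr, h, hcount r hr]
    have h2 : ∀ j : Fin m,
        rowOf lam ((f (Fin.castLE hmn j) : Fin n) : ℕ) = rowOf lamt (j : ℕ) := by
      obtain ⟨σ, hσ⟩ := exists_perm_comp_eq
        (fun k : Fin m => (rowOf muR (k : ℕ),
          rowOf lam ((f (Fin.castLE hmn (u k)) : Fin n) : ℕ)))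
        (fun k : Fin m => (rowOf muR (k : ℕ), rowOf lamt ((dt⁻¹ k : Fin m) : ℕ)))
        (by rintro ⟨r, s⟩; simpa [rowCount] using h1 r s)
      have hcomp : (fun j : Fin m => rowOf lam ((f (Fin.castLE hmn j) : Fin n) : ℕ)) ∘
          (u * σ * dt) = fun j : Fin m => rowOf lamt (j : ℕ) := by
        funext j
        have := congrArg Prod.snd (hσ (dt j))
        simpa using this
      have hfm : Monotone fun j : Fin m => rowOf lam ((f (Fin.castLE hmn j) : Fin n) : ℕ) := by
        intro a a' haa
        rcases haa.lt_or_eq with hlt | rfl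
        · exact hlam _ _ (hf a a' hlt rfl).le
        · exact le_rfl
      have := comp_perm_eq_of_monotone hfm (σ := u * σ * dt) (by
        rw [hcomp]; exact fun a a' haa => hlamt _ _ haa)
      rw [hcomp] at this
      exact fun j => (congrFun this j).symm
    refine ⟨h2, fun r s => ?_⟩
    rw [← h1 r s, rowCount, inv_inv]
    simp only [h2]
  · rintro ⟨h1, h2⟩
    have h3 : ∀ r, r ≠ b → ∀ s,
        rowCount mu lam (f * permEmb hmn u)⁻¹ r s = rowCount mu lam d r s := by
      intro r hr s
      rw [rowCount_inv_mul_permEmb hmn hrow hlast hr, hcount r hr, ← h2 r s, rowCount, inv_inv]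
      simp only [h1]
    intro r s
    by_cases hr : r = b
    · rw [hr]
      exact rowCount_eq_of_forall_ne h3 s
    · exact h3 r hr s

lemma XPhi_eq_sum_inv {H : Type*} [Ring H] (T : Equiv.Perm (Fin n) → H) (lam mu : ℕ → ℕ)
    (d : Equiv.Perm (Fin n)) :
    XPhi T lam mu d = ∑ w : Equiv.Perm (Fin n),
      if w⁻¹ ∈ doubleCoset lam mu d then T w⁻¹ else 0 := by
  rw [XPhi, Finset.sum_filter]
  exact (Equiv.sum_comp (Equiv.inv (Equiv.Perm (Fin n))) _).symm

/-- The image of `x_μ` under a tableau homomorphism factors through its analogue for the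
tableau with the bottom row removed, with a left factor depending only on the types. -/
theorem XPhi_eq_mul_heckeEmb {F : Type*} [Field F] {H : Type*} [Ring H] [Algebra F H]
    {H' : Type*} [Ring H'] [Algebra F H'] {q : F} {T : Equiv.Perm (Fin n) → H}
    (hT : IsHeckeBasis q T) {T' : Equiv.Perm (Fin m) → H'} (hT' : IsHeckeBasis q T')
    (hrow : ∀ k : Fin m, rowOf mu (k : ℕ) = rowOf muR (k : ℕ))
    (hlast : ∀ k : Fin n, m ≤ (k : ℕ) → rowOf mu (k : ℕ) = b)
    (hb : ∀ k : Fin m, rowOf muR (k : ℕ) ≠ b)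
    (hlam : ∀ p p' : Fin n, p ≤ p' → rowOf lam (p : ℕ) ≤ rowOf lam (p' : ℕ))
    (hlamt : ∀ p p' : Fin m, p ≤ p' → rowOf lamt (p : ℕ) ≤ rowOf lamt (p' : ℕ))
    {d : Equiv.Perm (Fin n)} {dt : Equiv.Perm (Fin m)}
    (hcount : ∀ r, r ≠ b → ∀ s, rowCount mu lam d r s = rowCount muR lamt dt r s) :
    XPhi T lam mu d =
      (∑ f ∈ Finset.univ.filter (IncreasingOnFibers hmn (fun _ : Fin m => 0)),
        if ∀ j : Fin m, rowOf lam ((f (Fin.castLE hmn j) : Fin n) : ℕ) = rowOf lamt (j : ℕ)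
          then T f⁻¹ else 0) * heckeEmb hmn hT' T (XPhi T' lamt muR dt) := by
  rw [XPhi_eq_sum_inv, XPhi_eq_sum_inv,
    sum_perm_eq_sum_increasing hmn (β := fun _ : Fin m => 0) monotone_const,
    Finset.sum_mul]
  refine Finset.sum_congr rfl fun f hf => ?_
  rw [Finset.mem_filter] at hf
  rw [map_sum, Finset.mul_sum, Finset.filter_true_of_mem fun _ _ _ => rfl]
  refine Finset.sum_congr rfl fun u _ => ?_
  rw [apply_ite (heckeEmb hmn hT' T), map_zero, heckeEmb_apply, ite_zero_mul_ite_zero,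
    hT.mul_eq (preservesInv_permEmb_right hmn f⁻¹ u⁻¹ fun a a' haa => by
      rw [inv_inv]; exact hf.2 a a' haa rfl)]
  refine if_congr (inv_mul_permEmb_mem_doubleCoset_iff hmn hrow hlast hb hlam hlamt hcount
    hf.2 u) ?_ rfl
  rw [mul_inv_rev, map_inv]

end Restriction

end DoubleCosets

section Tableaux

lemma IsComposition.exists_lt_cumSum {lam : ℕ → ℕ} (h : IsComposition n lam) :
    ∃ N, ∀ p : Fin n, (p : ℕ) < cumSum lam N := by
  obtain ⟨N, -, hN⟩ := h
  exact ⟨N, fun p => hN ▸ p.2⟩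

lemma IsComposition.rowOf_mono {lam : ℕ → ℕ} (h : IsComposition n lam) (p p' : Fin n)
    (hp : p ≤ p') : rowOf lam (p : ℕ) ≤ rowOf lam (p' : ℕ) := by
  obtain ⟨N, hN⟩ := h.exists_lt_cumSum
  exact FayersSemistd.rowOf_mono hp (hN p')

lemma count_row {mu : ℕ → ℕ} {A : ℕ → Multiset ℕ} (hA : RowsOfShape mu A) (r s : ℕ) :
    (A r).count s = ((Finset.range (mu r)).filter fun c => entryAt A r c = s).card := by
  have h1 : A r = Multiset.map (entryAt A r) (Multiset.range (mu r)) := by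
    have hlen : ((A r).sort (· ≤ ·)).length = mu r := by rw [Multiset.length_sort, hA r]
    conv_lhs => rw [← Multiset.sort_eq (A r) (· ≤ ·)]
    rw [Multiset.range, Multiset.map_coe, Multiset.coe_eq_coe]
    refine List.Perm.of_eq (List.ext_getElem (by simp [hlen]) fun c h1 h2 => ?_)
    simp [entryAt, List.getElem?_eq_getElem h1]
  conv_lhs => rw [h1, Multiset.count_map]
  simp only [eq_comm (a := s)]
  rfl

lemma rowCount_of_is1A {mu lam : ℕ → ℕ} (hmu : IsComposition n mu) {A : ℕ → Multiset ℕ}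
    (hA : RowsOfShape mu A) {d : Equiv.Perm (Fin n)} (hd : Is1A mu lam A d) (r s : ℕ) :
    rowCount mu lam d r s = (A r).count s := by
  obtain ⟨N, hN⟩ := hmu.exists_lt_cumSum
  have hentry : ∀ k : Fin n, entryAt A (rowOf mu (k : ℕ)) ((k : ℕ) - cumSum mu (rowOf mu (k : ℕ)))
      = rowOf lam ((d⁻¹ k : Fin n) : ℕ) := fun k => by simpa using hd.2 (d⁻¹ k)
  rw [count_row hA, rowCount]
  refine Finset.card_bij (fun k _ => (k : ℕ) - cumSum mu r) ?_ ?_ ?_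
  · intro k hk
    simp only [Finset.mem_filter, Finset.mem_univ, true_and] at hk
    obtain ⟨rfl, hk⟩ := hk
    have h1 := lt_cumSum_rowOf_succ (hN k)
    have h2 := cumSum_rowOf_le mu k
    rw [cumSum_succ] at h1
    rw [Finset.mem_filter, Finset.mem_range]
    exact ⟨by omega, (hentry k).trans hk⟩
  · intro k hk k' hk' he
    simp only [Finset.mem_filter, Finset.mem_univ, true_and] at hk hk'
    have h1 := cumSum_rowOf_le mu k
    have h2 := cumSum_rowOf_le mu k'
    rw [hk.1] at h1
    rw [hk'.1] at h2
    exact Fin.ext (by omega)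
  · intro c hc
    rw [Finset.mem_filter, Finset.mem_range] at hc
    have h1 := hmu.cumSum_le (r + 1)
    rw [cumSum_succ] at h1
    have h2 : rowOf mu (cumSum mu r + c) = r :=
      rowOf_eq (by omega) (by rw [cumSum_succ]; omega)
    refine ⟨⟨cumSum mu r + c, by omega⟩, ?_, by simp⟩
    simp only [Finset.mem_filter, Finset.mem_univ, true_and]
    refine ⟨h2, ?_⟩
    rw [← hentry]
    simp only [h2, Nat.add_sub_cancel_left]
    exact hc.2

lemma HasType.exists_lt_cumSum {mu lam : ℕ → ℕ} {A : ℕ → Multiset ℕ} {R : ℕ}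
    (hmu : cumSum mu R = n) (hR : ∀ r, R ≤ r → A r = 0) (hA : RowsOfShape mu A)
    (hlam : HasType A lam) : ∃ N, ∀ p : Fin n, (p : ℕ) < cumSum lam N := by
  set S : Multiset ℕ := ∑ r ∈ Finset.range R, A r with hS
  have hcard : S.card = n := by
    rw [hS, Multiset.card_sum, ← hmu, cumSum]
    exact Finset.sum_congr rfl fun r _ => hA r
  have hcount : ∀ v, lam v = S.count v := by
    intro v
    rw [← hlam v, hS, Multiset.count_sum']
    refine finsum_eq_sum_of_support_subset _ fun r hr => ?_
    by_contra hcon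
    refine hr ?_
    change (A r).count v = 0
    rw [hR r (by simpa using hcon), Multiset.count_zero]
  refine ⟨S.toFinset.sup id + 1, fun p => ?_⟩
  have : cumSum lam (S.toFinset.sup id + 1) = n := by
    rw [← hcard, cumSum, ← Multiset.sum_count_eq_card (s := Finset.range _)]
    · exact Finset.sum_congr rfl fun v _ => hcount v
    · intro a ha
      rw [Finset.mem_range, Nat.lt_succ_iff]
      exact Finset.le_sup (f := id) (Multiset.mem_toFinset.mpr ha)
  rw [this]
  exact p.2

end Tableaux

section Conjugate

variable {mu : ℕ → ℕ}

lemma IsPartition.colIdx_lt (hmu : IsPartition n mu) (p : Fin n) :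
    colIdx mu p < mu (rowOf mu p) := by
  obtain ⟨N, hN⟩ := hmu.1.exists_lt_cumSum
  have h1 := lt_cumSum_rowOf_succ (hN p)
  have h2 := cumSum_rowOf_le mu p
  rw [cumSum_succ] at h1
  unfold colIdx
  omega

lemma IsPartition.lt_conjP_iff (hmu : IsPartition n mu) (r j : ℕ) :
    r < conjP mu j ↔ j < mu r := by
  constructor
  · intro h
    exact not_le.mp (Nat.notMem_of_lt_sInf (s := {r | mu r ≤ j}) h)
  · intro h
    by_contra hcon
    obtain ⟨N, hN, -⟩ := hmu.1
    have h1 : mu (conjP mu j) ≤ j := Nat.sInf_mem (s := {r | mu r ≤ j})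
      ⟨N, (hN N le_rfl).le.trans (Nat.zero_le _)⟩
    have := hmu.2 (not_lt.mp hcon)
    omega

lemma IsPartition.card_colIdx_eq (hmu : IsPartition n mu) (j : ℕ) :
    (Finset.univ.filter fun p : Fin n => colIdx mu (p : ℕ) = j).card = conjP mu j := by
  rw [← Finset.card_range (conjP mu j)]
  refine Finset.card_bij (fun p _ => rowOf mu (p : ℕ)) ?_ ?_ ?_
  · intro p hp
    rw [Finset.mem_filter] at hp
    rw [Finset.mem_range, hmu.lt_conjP_iff, ← hp.2]
    exact hmu.colIdx_lt p
  · intro p hp p' hp' he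
    rw [Finset.mem_filter] at hp hp'
    have h1 := cumSum_rowOf_le mu p
    have h2 := cumSum_rowOf_le mu p'
    have h3 := hp.2.trans hp'.2.symm
    unfold colIdx at h3
    rw [he] at h1 h3
    exact Fin.ext (by omega)
  · intro r hr
    rw [Finset.mem_range, hmu.lt_conjP_iff] at hr
    have h1 := hmu.1.cumSum_le (r + 1)
    rw [cumSum_succ] at h1
    have h2 : rowOf mu (cumSum mu r + j) = r :=
      rowOf_eq (by omega) (by rw [cumSum_succ]; omega)
    exact ⟨⟨cumSum mu r + j, by omega⟩,
      Finset.mem_filter.mpr ⟨Finset.mem_univ _, by simp [colIdx, h2]⟩, h2⟩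

lemma IsPartition.cumSum_conjP (hmu : IsPartition n mu) (c : ℕ) :
    cumSum (conjP mu) c = (Finset.univ.filter fun p : Fin n => colIdx mu (p : ℕ) < c).card := by
  induction c with
  | zero => simp [cumSum]
  | succ c ih =>
    rw [cumSum_succ, ih, ← hmu.card_colIdx_eq c, ← Finset.card_union_of_disjoint]
    · congr 1
      ext p
      rw [Finset.mem_union, Finset.mem_filter, Finset.mem_filter, Finset.mem_filter,
        Nat.lt_succ_iff_lt_or_eq]
      tauto
    · rw [Finset.disjoint_filter]
      intro p _ h1 h2
      omega

lemma IsPartition.rowOf_conjP_mono (hmu : IsPartition n mu) (p p' : Fin n) (hp : p ≤ p') :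
    rowOf (conjP mu) (p : ℕ) ≤ rowOf (conjP mu) (p' : ℕ) := by
  refine rowOf_mono (N := mu 0) hp ?_
  rw [hmu.cumSum_conjP, Finset.filter_true_of_mem, Finset.card_univ, Fintype.card_fin]
  · exact p'.2
  · exact fun x _ => (hmu.colIdx_lt x).trans_le (hmu.2 (Nat.zero_le _))

/-- `w_μ` carries the columns of the diagram of `μ` to the blocks of the conjugate partition. -/
lemma IsPartition.rowOf_conjP_apply (hmu : IsPartition n mu) {w : Equiv.Perm (Fin n)}
    (hw : IsWmu mu w) (p : Fin n) :
    rowOf (conjP mu) ((w p : Fin n) : ℕ) = colIdx mu (p : ℕ) := by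
  apply rowOf_eq
  · rw [hw p, hmu.cumSum_conjP]
    exact Finset.card_le_card (Finset.monotone_filter_right _ fun _ _ h => Or.inl h)
  · rw [hw p, hmu.cumSum_conjP]
    refine Finset.card_lt_card (Finset.ssubset_iff_of_subset ?_ |>.mpr ⟨p, ?_, ?_⟩)
    · refine Finset.monotone_filter_right _ fun p' _ h => ?_
      rcases h with h | h <;> omega
    · simp
    · simp

lemma IsWmu.lt_of_lex {w : Equiv.Perm (Fin n)} (hw : IsWmu mu w) {p p' : Fin n}
    (h : colIdx mu (p : ℕ) < colIdx mu (p' : ℕ) ∨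
      (colIdx mu (p : ℕ) = colIdx mu (p' : ℕ) ∧ rowOf mu (p : ℕ) < rowOf mu (p' : ℕ))) :
    w p < w p' := by
  rw [Fin.lt_def, hw p, hw p']
  refine Finset.card_lt_card (Finset.ssubset_iff_of_subset ?_ |>.mpr ⟨p, ?_, ?_⟩)
  · refine Finset.monotone_filter_right _ fun x _ hx => ?_
    omega
  · simpa using h
  · simp

lemma IsWmu.lt_iff_lex {w : Equiv.Perm (Fin n)} (hw : IsWmu mu w) {p p' : Fin n} :
    w p < w p' ↔ colIdx mu (p : ℕ) < colIdx mu (p' : ℕ) ∨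
      (colIdx mu (p : ℕ) = colIdx mu (p' : ℕ) ∧ rowOf mu (p : ℕ) < rowOf mu (p' : ℕ)) := by
  refine ⟨fun h => ?_, hw.lt_of_lex⟩
  by_contra hcon
  by_cases heq : colIdx mu (p : ℕ) = colIdx mu (p' : ℕ) ∧ rowOf mu (p : ℕ) = rowOf mu (p' : ℕ)
  · rw [Fin.lt_def, hw p, hw p', heq.1, heq.2] at h
    exact lt_irrefl _ h
  · exact lt_asymm h (hw.lt_of_lex (by omega))

end Conjugate

section ColumnStabilizer

variable {F : Type*} [Field F] {H : Type*} [Ring H] [Algebra F H]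
  {H' : Type*} [Ring H'] [Algebra F H'] {q : F} {m : ℕ} (hmn : m ≤ n)
  {T : Equiv.Perm (Fin n) → H} {T' : Equiv.Perm (Fin m) → H'}

lemma mul_mem_youngW_iff {lam : ℕ → ℕ} {w t : Equiv.Perm (Fin n)} (ht : t ∈ youngW lam) :
    w * t ∈ youngW lam ↔ w ∈ youngW lam := by
  constructor
  · intro h p
    have h1 := h (t⁻¹ p)
    have h2 := ht (t⁻¹ p)
    rw [Equiv.Perm.mul_apply] at h1
    rw [Equiv.Perm.inv_def, Equiv.apply_symm_apply] at h1 h2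
    rw [h1, h2]
  · intro h p
    rw [Equiv.Perm.mul_apply, h, ht]

/-- If `g` maps the first `m` letters increasingly, carries blocks of `κ` into blocks of `ν`
and is a minimal length coset representative for the Young subgroup of `ν`, then `T_g y_ν` is
left divisible by `y_κ`. -/
theorem exists_mul_yElt_eq (hq : q ≠ 0) (hT : IsHeckeBasis q T) (hT' : IsHeckeBasis q T')
    {kap nu : ℕ → ℕ} {g : Equiv.Perm (Fin n)}
    (hkap : ∀ a b : Fin m, a ≤ b → rowOf kap (a : ℕ) ≤ rowOf kap (b : ℕ))
    (hrow : ∀ a : Fin m, rowOf nu ((g (Fin.castLE hmn a) : Fin n) : ℕ) = rowOf kap (a : ℕ))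
    (hmin : ∀ v ∈ youngW nu, PreservesInv g v) :
    ∃ Z : H, T g * yElt q T nu = heckeEmb hmn hT' T (yElt q T' kap) * Z := by
  have hq' : -q ≠ 0 := neg_ne_zero.mpr hq
  set β : Fin m → ℕ := fun a => rowOf kap (a : ℕ)
  set c : Equiv.Perm (Fin n) → F := fun w => (-q) ^ permLength g * ((-q)⁻¹) ^ permLength w with hc
  refine ⟨∑ f ∈ Finset.univ.filter (IncreasingOnFibers hmn β),
    if f * g⁻¹ ∈ youngW nu then c f • T f else 0, ?_⟩
  have hstep : T g * yElt q T nu = ∑ w : Equiv.Perm (Fin n),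
      if w * g⁻¹ ∈ youngW nu then c w • T w else 0 := by
    rw [yElt, Finset.mul_sum, Finset.sum_filter]
    refine Fintype.sum_equiv (Equiv.mulRight g) _ _ fun v => ?_
    rw [Equiv.coe_mulRight, mul_inv_cancel_right]
    split_ifs with hv
    · rw [mul_smul_comm, hT.mul_eq (hmin v hv)]
      congr 1
      rw [hc]
      simp only
      rw [(hmin v hv).permLength_mul, pow_add, ← mul_assoc, ← mul_pow, mul_inv_cancel₀ hq',
        one_pow, one_mul]
    · rfl
  have hconj : ∀ u ∈ youngW (n := m) kap, g * permEmb hmn u * g⁻¹ ∈ youngW nu := by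
    intro u hu p
    obtain ⟨x, rfl⟩ := g.surjective p
    rw [Equiv.Perm.mul_apply, Equiv.Perm.mul_apply, Equiv.Perm.inv_def, Equiv.symm_apply_apply]
    by_cases hx : (x : ℕ) < m
    · have ex : x = Fin.castLE hmn ⟨x, hx⟩ := rfl
      rw [ex, permEmb_castLE, hrow, hrow, hu]
    · rw [permEmb_of_le hmn u (not_lt.mp hx)]
  rw [hstep, sum_perm_eq_sum_increasing hmn (β := β) hkap, yElt, map_sum, Finset.sum_mul,
    Finset.sum_comm]
  refine Finset.sum_congr (Finset.filter_congr fun _ _ => Iff.rfl) fun u hu => ?_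
  rw [Finset.mul_sum]
  refine Finset.sum_congr rfl fun f hf => ?_
  rw [Finset.mem_filter] at hu hf
  have hu' : u ∈ youngW (n := m) kap := hu.2
  have hiff : f * permEmb hmn u * g⁻¹ ∈ youngW nu ↔ f * g⁻¹ ∈ youngW nu := by
    rw [← mul_mem_youngW_iff (w := f * g⁻¹) (hconj u hu')]
    have : f * permEmb hmn u * g⁻¹ = f * g⁻¹ * (g * permEmb hmn u * g⁻¹) := by group
    rw [this]
  have hinv : PreservesInv (permEmb hmn u) f := by
    refine preservesInv_permEmb_left hmn u f fun a b hab hlt => hf.2 _ _ hlt ?_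
    have h1 := hkap _ _ hlt.le
    have h2 := hkap _ _ hab.le
    rw [hu', hu'] at h1
    change rowOf kap _ = rowOf kap _
    rw [hu', hu']
    exact le_antisymm h1 h2
  rw [if_congr hiff rfl rfl, mul_ite, mul_zero, map_smul, heckeEmb_apply, smul_mul_smul_comm,
    hT.mul_eq hinv]
  refine if_congr Iff.rfl ?_ rfl
  congr 1
  rw [hc]
  simp only
  rw [hinv.permLength_mul, permLength_permEmb, pow_add]
  ring

theorem exists_mul_wmu_yElt_eq (hq : q ≠ 0) (hT : IsHeckeBasis q T)
    (hT' : IsHeckeBasis q T') {mu muR : ℕ → ℕ} {b : ℕ} (hmu : IsPartition n mu)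
    (hmuR : IsPartition m muR)
    (hrow : ∀ k : Fin m, rowOf mu (k : ℕ) = rowOf muR (k : ℕ))
    (hcol : ∀ k : Fin m, colIdx mu (k : ℕ) = colIdx muR (k : ℕ))
    (hlast : ∀ k : Fin n, m ≤ (k : ℕ) → rowOf mu (k : ℕ) = b)
    (hb : ∀ k : Fin n, rowOf mu (k : ℕ) ≤ b)
    {w : Equiv.Perm (Fin n)} (hw : IsWmu mu w)
    {wR : Equiv.Perm (Fin m)} (hwR : IsWmu muR wR) :
    ∃ Z : H, T w * yElt q T (conjP mu) =
      heckeEmb hmn hT' T (T' wR * yElt q T' (conjP muR)) * Z := by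
  set g : Equiv.Perm (Fin n) := w * (permEmb hmn wR)⁻¹ with hg
  have hgw : g * permEmb hmn wR = w := by rw [hg, inv_mul_cancel_right]
  have hgapp : ∀ a : Fin m, g (Fin.castLE hmn a) = w (Fin.castLE hmn (wR⁻¹ a)) := fun a => by
    rw [hg, ← map_inv, Equiv.Perm.mul_apply, permEmb_castLE]
  have hmono : ∀ a b : Fin m, a < b → g (Fin.castLE hmn a) < g (Fin.castLE hmn b) := by
    intro a b hab
    rw [hgapp, hgapp, hw.lt_iff_lex]
    simp only [Fin.val_castLE, hrow, hcol]
    rw [← hwR.lt_iff_lex]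
    simpa using hab
  have hgrow : ∀ a : Fin m, rowOf (conjP mu) ((g (Fin.castLE hmn a) : Fin n) : ℕ) =
      rowOf (conjP muR) (a : ℕ) := by
    intro a
    rw [hgapp, hmu.rowOf_conjP_apply hw, Fin.val_castLE, hcol, ← hmuR.rowOf_conjP_apply hwR,
      Equiv.Perm.inv_def, Equiv.apply_symm_apply]
  have hmin : ∀ v ∈ youngW (n := n) (conjP mu), PreservesInv g v := by
    intro v hv x y hxy hlt
    by_contra hcon
    have h1 := hmu.rowOf_conjP_mono _ _ (not_lt.mp hcon)
    rw [hv, hv] at h1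
    have h2 := le_antisymm h1 (hmu.rowOf_conjP_mono _ _ hlt.le)
    have hx : g x = w ((permEmb hmn wR)⁻¹ x) := rfl
    by_cases hy : (y : ℕ) < m
    · have hxm : (x : ℕ) < m := lt_trans hxy hy
      exact lt_asymm hlt (hmono ⟨x, hxm⟩ ⟨y, hy⟩ hxy)
    · have hgy : g y = w y := by
        rw [hg, ← map_inv, Equiv.Perm.mul_apply, permEmb_of_le hmn _ (not_lt.mp hy)]
      rw [hx, hgy, hmu.rowOf_conjP_apply hw, hmu.rowOf_conjP_apply hw] at h2
      rw [hx, hgy, hw.lt_iff_lex] at hlt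
      have h3 := hlast y (not_lt.mp hy)
      have h4 := hb ((permEmb hmn wR)⁻¹ x)
      omega
  obtain ⟨Z, hZ⟩ := exists_mul_yElt_eq hmn hq hT hT'
    (fun a b hab => hmuR.rowOf_conjP_mono a b hab) hgrow hmin
  refine ⟨Z, ?_⟩
  rw [heckeEmb_mul hmn hT' hT, heckeEmb_apply, mul_assoc, ← hZ, ← mul_assoc,
    hT.mul_eq (preservesInv_permEmb_left hmn wR g fun a b _ hlt => hmono _ _ hlt), hgw]

end ColumnStabilizer

section RemoveRow

variable {mu : ℕ → ℕ} {L : ℕ}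

lemma cumSum_truncate {r : ℕ} (hr : r + 1 ≤ L) :
    cumSum (fun s => if s + 1 < L then mu s else 0) r = cumSum mu r := by
  refine Finset.sum_congr rfl fun s hs => if_pos ?_
  have := Finset.mem_range.mp hs
  omega

lemma IsComposition.cumSum_eq (hmu : IsComposition n mu) (hL : ∀ s, mu s = 0 ↔ L ≤ s) :
    cumSum mu L = n := by
  obtain ⟨N, hN, rfl⟩ := hmu
  refine Finset.sum_subset (Finset.range_subset_range.mpr ((hL N).mp (hN N le_rfl))) ?_
  intro x _ hx
  exact (hL x).mpr (by simpa using hx)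

lemma IsPartition.cumSum_pred (hmu : IsPartition n mu) (hLpos : 0 < L)
    (hL : ∀ s, mu s = 0 ↔ L ≤ s) : cumSum mu (L - 1) = n - mu (L - 1) := by
  have h := hmu.1.cumSum_eq hL
  obtain ⟨l, rfl⟩ := Nat.exists_eq_add_of_lt hLpos
  rw [zero_add, cumSum_succ] at h
  simp only [zero_add, Nat.add_sub_cancel]
  omega

lemma IsPartition.truncate (hmu : IsPartition n mu) (hLpos : 0 < L)
    (hL : ∀ s, mu s = 0 ↔ L ≤ s) :
    IsPartition (n - mu (L - 1)) (fun s => if s + 1 < L then mu s else 0) := by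
  refine ⟨⟨L - 1, fun r hr => if_neg (by omega), ?_⟩, fun a b hab => ?_⟩
  · rw [cumSum_truncate (by omega), hmu.cumSum_pred hLpos hL]
  · have := hmu.2 hab
    dsimp only
    split_ifs <;> omega

lemma IsPartition.rowOf_truncate (hmu : IsPartition n mu) (hLpos : 0 < L)
    (hL : ∀ s, mu s = 0 ↔ L ≤ s) {k : ℕ} (hk : k < n - mu (L - 1)) :
    rowOf (fun s => if s + 1 < L then mu s else 0) k = rowOf mu k ∧
      colIdx (fun s => if s + 1 < L then mu s else 0) k = colIdx mu k ∧
      rowOf mu k + 1 < L := by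
  rw [← hmu.cumSum_pred hLpos hL] at hk
  have h1 := cumSum_rowOf_le mu k
  have h2 := lt_cumSum_rowOf_succ hk
  have h3 : rowOf mu k + 1 < L := by
    by_contra hcon
    have := cumSum_mono mu (show L - 1 ≤ rowOf mu k by omega)
    omega
  have h4 : rowOf (fun s => if s + 1 < L then mu s else 0) k = rowOf mu k :=
    rowOf_eq (by rwa [cumSum_truncate h3.le]) (by rwa [cumSum_truncate (by omega)])
  refine ⟨h4, ?_, h3⟩
  rw [colIdx, colIdx, h4, cumSum_truncate h3.le]

lemma IsPartition.rowOf_last (hmu : IsPartition n mu) (hLpos : 0 < L)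
    (hL : ∀ s, mu s = 0 ↔ L ≤ s) {k : ℕ} (hk : n - mu (L - 1) ≤ k) (hkn : k < n) :
    rowOf mu k = L - 1 := by
  refine rowOf_eq (by rwa [hmu.cumSum_pred hLpos hL]) ?_
  rwa [Nat.sub_add_cancel hLpos, hmu.1.cumSum_eq hL]

end RemoveRow

end FactorThroughRowRemoval

lemma map_mul_of_mem {R : Type*} [Ring R] {M : Submodule Rᵐᵒᵖ R} (g : M →ₗ[Rᵐᵒᵖ] R) {x : R}
    (hx : x ∈ M) {a : R} (ha : x * a ∈ M) : g ⟨x * a, ha⟩ = g ⟨x, hx⟩ * a :=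
  g.map_smul (MulOpposite.op a) ⟨x, hx⟩

/-- Proposition: removing the bottom row preserves relations.
`μ ⊢ n`, `λ ⊨ n`, `L` the number of nonzero parts of `μ` (so the last row is row
`L-1`, 0-indexed); `A_1,…,A_r` row-standard `μ`-tableaux of type `λ` identical in the
last row; `μ̃ = (μ_1,…,μ_{l-1}) ⊢ n - μ_l`; `Ã_i` obtained by deleting the last row,
of common type `λ̃`.  If `∑ c_i φ̂_{Ã_i} = 0` (homomorphisms `S^{μ̃} → M^{λ̃}` over
`H_{n-μ_l}`) then `∑ c_i φ̂_{A_i} = 0` (homomorphisms `S^μ → M^λ` over `H_n`). -/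
theorem row_removal_bottom
    {F : Type*} [Field F] {H : Type*} [Ring H] [Algebra F H]
    {H' : Type*} [Ring H'] [Algebra F H']
    {n : ℕ} (q : F) (hq : q ≠ 0)
    (mu lam : ℕ → ℕ) (hmu : IsPartition n mu) (hlam : IsComposition n lam)
    (L : ℕ) (hLpos : 0 < L) (hL : ∀ s, mu s = 0 ↔ L ≤ s)
    (T : Equiv.Perm (Fin n) → H) (hT : IsHeckeBasis q T)
    (T' : Equiv.Perm (Fin (n - mu (L-1))) → H') (hT' : IsHeckeBasis q T')
    (r : ℕ) (A : Fin r → ℕ → Multiset ℕ) (c : Fin r → F)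
    (hshape : ∀ i, RowsOfShape mu (A i)) (htype : ∀ i, HasType (A i) lam)
    (hrowL : ∀ i j, A i (L-1) = A j (L-1))
    (lamt : ℕ → ℕ)
    (hlamt : ∀ i, HasType (fun s => if s + 1 < L then A i s else 0) lamt)
    (d : Fin r → Equiv.Perm (Fin n)) (hd : ∀ i, Is1A mu lam (A i) (d i))
    (dt : Fin r → Equiv.Perm (Fin (n - mu (L-1))))
    (hdt : ∀ i, Is1A (fun s => if s + 1 < L then mu s else 0) lamt
      (fun s => if s + 1 < L then A i s else 0) (dt i))
    (wmu : Equiv.Perm (Fin n)) (hwmu : IsWmu mu wmu)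
    (wmut : Equiv.Perm (Fin (n - mu (L-1))))
    (hwmut : IsWmu (fun s => if s + 1 < L then mu s else 0) wmut)
    -- homomorphism data over `H_{n-μ_l}`
    (Mt : Submodule H'ᵐᵒᵖ H')
    (hMt : Mt = Submodule.span H'ᵐᵒᵖ {xElt T' (fun s => if s + 1 < L then mu s else 0)})
    (St : Submodule H'ᵐᵒᵖ H')
    (hSt : St = Submodule.span H'ᵐᵒᵖ
      {xElt T' (fun s => if s + 1 < L then mu s else 0) *
        (T' wmut * yElt q T' (conjP (fun s => if s + 1 < L then mu s else 0)))})
    (hlet : St ≤ Mt) (hxt : xElt T' (fun s => if s + 1 < L then mu s else 0) ∈ Mt)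
    (ψ : Fin r → (Mt →ₗ[H'ᵐᵒᵖ] H'))
    (hψ : ∀ i, ψ i ⟨xElt T' (fun s => if s + 1 < L then mu s else 0), hxt⟩
      = XPhi T' lamt (fun s => if s + 1 < L then mu s else 0) (dt i))
    (hyp : ∀ (z : H') (hz : z ∈ St), ∑ i, c i • ψ i ⟨z, hlet hz⟩ = 0)
    -- homomorphism data over `H_n`
    (Mmu : Submodule Hᵐᵒᵖ H) (hMmu : Mmu = Submodule.span Hᵐᵒᵖ {xElt T mu})
    (Smu : Submodule Hᵐᵒᵖ H)
    (hSmu : Smu = Submodule.span Hᵐᵒᵖ {xElt T mu * (T wmu * yElt q T (conjP mu))})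
    (hle : Smu ≤ Mmu) (hx : xElt T mu ∈ Mmu)
    (φ : Fin r → (Mmu →ₗ[Hᵐᵒᵖ] H))
    (hφ : ∀ i, φ i ⟨xElt T mu, hx⟩ = XPhi T lam mu (d i)) :
    ∀ (z : H) (hz : z ∈ Smu), ∑ i, c i • φ i ⟨z, hle hz⟩ = 0 := by
  subst hSt hSmu
  intro z hz
  rcases isEmpty_or_nonempty (Fin r) with hr | ⟨⟨i₀⟩⟩
  · exact Finset.sum_of_isEmpty _
  let muR : ℕ → ℕ := fun s => if s + 1 < L then mu s else 0
  have hmn : n - mu (L - 1) ≤ n := Nat.sub_le _ _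
  have hmuR : IsPartition (n - mu (L - 1)) muR := hmu.truncate hLpos hL
  have htrunc := fun k : Fin (n - mu (L - 1)) => hmu.rowOf_truncate hLpos hL k.2
  have hrow : ∀ k : Fin (n - mu (L - 1)), rowOf mu (k : ℕ) = rowOf muR (k : ℕ) :=
    fun k => (htrunc k).1.symm
  have hcol : ∀ k : Fin (n - mu (L - 1)), colIdx mu (k : ℕ) = colIdx muR (k : ℕ) :=
    fun k => (htrunc k).2.1.symm
  have hlast : ∀ k : Fin n, n - mu (L - 1) ≤ (k : ℕ) → rowOf mu (k : ℕ) = L - 1 :=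
    fun k hk => hmu.rowOf_last hLpos hL hk k.2
  have hb : ∀ k : Fin (n - mu (L - 1)), rowOf muR (k : ℕ) ≠ L - 1 := fun k => by
    have := (htrunc k).2.2
    rw [← hrow]
    omega
  have hb' : ∀ k : Fin n, rowOf mu (k : ℕ) ≤ L - 1 := fun k => by
    rcases lt_or_ge (k : ℕ) (n - mu (L - 1)) with hk | hk
    · have := (htrunc ⟨k, hk⟩).2.2
      simp only at this
      omega
    · exact (hlast k hk).le
  have hshapet : ∀ i, RowsOfShape muR fun s => if s + 1 < L then A i s else 0 := fun i s => by
    simp only [muR]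
    split_ifs
    · exact hshape i s
    · rfl
  have hlamt' : ∀ p p' : Fin (n - mu (L - 1)), p ≤ p' →
      rowOf lamt (p : ℕ) ≤ rowOf lamt (p' : ℕ) := by
    obtain ⟨N, hN⟩ := HasType.exists_lt_cumSum (n := n - mu (L - 1)) (R := L - 1)
      (by rw [cumSum_truncate (by omega), hmu.cumSum_pred hLpos hL])
      (fun s hs => if_neg (by omega)) (hshapet i₀) (hlamt i₀)
    exact fun p p' hp => rowOf_mono hp (hN p')
  have hcount : ∀ i s, s ≠ L - 1 → ∀ v,
      rowCount mu lam (d i) s v = rowCount muR lamt (dt i) s v := by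
    intro i s hs v
    rw [rowCount_of_is1A hmu.1 (hshape i) (hd i), rowCount_of_is1A hmuR.1 (hshapet i) (hdt i)]
    by_cases hsL : s + 1 < L
    · rw [if_pos hsL]
    · have h0 : A i s = 0 := by
        rw [← Multiset.card_eq_zero, hshape i s, hL]
        omega
      rw [if_neg hsL, h0]
  have hX := fun i => XPhi_eq_mul_heckeEmb hmn hT hT' hrow hlast hb hlam.rowOf_mono hlamt'
    (hcount i)
  obtain ⟨Z, hZ⟩ := exists_mul_wmu_yElt_eq hmn hq hT hT' hmu hmuR hrow hcol hlast hb' hwmu hwmut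
  have hrel : (∑ i, c i • XPhi T' lamt muR (dt i)) * (T' wmut * yElt q T' (conjP muR)) = 0 := by
    rw [← hyp _ (Submodule.mem_span_singleton_self _), Finset.sum_mul]
    refine Finset.sum_congr rfl fun i _ => ?_
    rw [map_mul_of_mem (ψ i) hxt, hψ, smul_mul_assoc]
  obtain ⟨a, rfl⟩ := Submodule.mem_span_singleton.mp hz
  have hterm : ∀ i, φ i ⟨a • (xElt T mu * (T wmu * yElt q T (conjP mu))), hle hz⟩ =
      XPhi T lam mu (d i) * (T wmu * yElt q T (conjP mu) * a.unop) := fun i => by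
    rw [← hφ i, ← map_mul_of_mem (φ i) hx (by
      rw [← mul_assoc]
      exact hle hz)]
    congr 2
    exact mul_assoc _ _ _
  simp only [hterm, ← smul_mul_assoc, ← Finset.sum_mul]
  simp only [hX, ← mul_smul_comm, ← map_smul, ← Finset.mul_sum, ← map_sum]
  rw [hZ, mul_assoc, mul_assoc, ← mul_assoc (heckeEmb hmn hT' T _),
    ← heckeEmb_mul hmn hT' hT, hrel, map_zero, zero_mul, mul_zero]

end FayersSemistd
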